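/- arXiv:2402.04951 — 2 statements merged into one kernel-verified Lean document; each statement's English description precedes it below -/
import Mathlib

section
/- Let κ > 1 and let κ' := κ/(κ−1) be its Hölder conjugate. Suppose the sequences (Y_l)_{l≥0} ⊂ [0,∞) and (p_l)_{l≥0} ⊂ [1,∞) admit constants A, B ∈ (1,∞) and μ > 0 such that Y_{l+1}^{p_{l+1}} ≤ (A·B^l·Y_l^{p_l})^κ and p_l ≥ μ·(κ^l − 1) for all l ≥ 0, and κ^l / p_l → 1/μ as l → ∞. Then limsup_{l→∞} Y_l ≤ A^{κ'/μ} · B^{(κ')²/μ} · Y₀^{p₀/μ}. -/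
open Filter

/-- Iterating `Z_{l+1} ≤ (A B^l Z_l)^κ` bounds `Z_l` by `(A^{κ'} B^{κ'²} Z₀)^{κ^l}`. -/
theorem le_rpow_of_succ_le_rpow {κ A B : ℝ} {Z : ℕ → ℝ} (hκ : 1 < κ) (hA : 1 ≤ A) (hB : 1 ≤ B)
    (hZ : ∀ l, 0 ≤ Z l) (hrec : ∀ l : ℕ, Z (l + 1) ≤ (A * B ^ (l : ℝ) * Z l) ^ κ) (l : ℕ) :
    Z l ≤ (A ^ (κ / (κ - 1)) * B ^ ((κ / (κ - 1)) ^ 2) * Z 0) ^ (κ ^ (l : ℝ)) := by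
  have hA0 : 0 < A := by linarith
  have hB0 : 0 < B := by linarith
  have hκ0 : 0 < κ := by linarith
  have hκ1 : 0 < κ - 1 := by linarith
  set a := κ / (κ - 1) with ha
  set c := κ / (κ - 1) ^ 2 with hc
  have ha0 : 0 < a := by positivity
  have hc0 : 0 < c := by positivity
  have haκ : κ + a = a * κ := by rw [ha]; field_simp; ring
  have hcκ : a + c = c * κ := by rw [ha, hc]; field_simp; ring
  have hca : c ≤ a ^ 2 := by
    rw [ha, hc, div_pow]
    gcongr
    nlinarith
  have key : A ^ a * B ^ (a * l + c) * Z l ≤ (A ^ a * B ^ c * Z 0) ^ (κ ^ (l : ℝ)) := by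
    induction l with
    | zero => simp
    | succ l ih =>
      have hZl := hZ l
      calc A ^ a * B ^ (a * ((l + 1 : ℕ) : ℝ) + c) * Z (l + 1)
          ≤ A ^ a * B ^ (a * ((l + 1 : ℕ) : ℝ) + c) * (A * B ^ (l : ℝ) * Z l) ^ κ := by
            gcongr
            exact hrec l
        _ = A ^ (κ + a) * B ^ (l * κ + (a * ((l + 1 : ℕ) : ℝ) + c)) * Z l ^ κ := by
            rw [Real.mul_rpow (by positivity) hZl, Real.mul_rpow hA0.le (by positivity),
              ← Real.rpow_mul hB0.le, Real.rpow_add hA0, Real.rpow_add hB0 (l * κ)]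
            ring
        _ = (A ^ a * B ^ (a * l + c) * Z l) ^ κ := by
            have hexp : l * κ + (a * ((l + 1 : ℕ) : ℝ) + c) = (a * l + c) * κ := by
              push_cast
              linear_combination (l : ℝ) * haκ + hcκ
            rw [haκ, hexp, Real.mul_rpow (by positivity) hZl,
              Real.mul_rpow (by positivity) (by positivity), ← Real.rpow_mul hB0.le,
              ← Real.rpow_mul hA0.le]
        _ ≤ ((A ^ a * B ^ c * Z 0) ^ (κ ^ (l : ℝ))) ^ κ := by gcongr
        _ = (A ^ a * B ^ c * Z 0) ^ (κ ^ ((l + 1 : ℕ) : ℝ)) := by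
            have hZ0 := hZ 0
            rw [← Real.rpow_mul (by positivity), Real.rpow_natCast, Real.rpow_natCast, pow_succ]
  have hZ0 := hZ 0
  calc Z l ≤ A ^ a * B ^ (a * l + c) * Z l := by
        refine le_mul_of_one_le_left (hZ l) (one_le_mul_of_one_le_of_one_le ?_ ?_)
        · exact Real.one_le_rpow hA ha0.le
        · exact Real.one_le_rpow hB (by positivity)
    _ ≤ (A ^ a * B ^ c * Z 0) ^ (κ ^ (l : ℝ)) := key
    _ ≤ (A ^ a * B ^ (a ^ 2) * Z 0) ^ (κ ^ (l : ℝ)) := by gcongr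

/-- Moser-type iteration lemma: if `Y_{l+1}^{p_{l+1}} ≤ (A B^l Y_l^{p_l})^κ`,
`p_l ≥ μ (κ^l - 1)`, and `κ^l / p_l → 1/μ`, then
`limsup Y_l ≤ A^{κ'/μ} B^{κ'²/μ} Y₀^{p₀/μ}` where `κ' = κ/(κ-1)`. -/
theorem stmt1 (κ : ℝ) (hκ : 1 < κ) (Y p : ℕ → ℝ) (A B μ : ℝ)
    (hY : ∀ l, 0 ≤ Y l) (hp : ∀ l, 1 ≤ p l)
    (hA : 1 < A) (hB : 1 < B) (hμ : 0 < μ)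
    (hrec : ∀ l : ℕ, Y (l + 1) ^ p (l + 1) ≤ (A * B ^ (l : ℝ) * Y l ^ p l) ^ κ)
    (hplow : ∀ l : ℕ, μ * (κ ^ (l : ℝ) - 1) ≤ p l)
    (hlim : Tendsto (fun l : ℕ => κ ^ (l : ℝ) / p l) atTop (nhds (1 / μ))) :
    limsup Y atTop ≤
      A ^ ((κ / (κ - 1)) / μ) * B ^ ((κ / (κ - 1)) ^ 2 / μ) * Y 0 ^ (p 0 / μ) := by
  have hA0 : 0 < A := by linarith
  have hB0 : 0 < B := by linarith
  set C := A ^ (κ / (κ - 1)) * B ^ ((κ / (κ - 1)) ^ 2) * Y 0 ^ p 0 with hC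
  have hZ0 : 0 ≤ Y 0 ^ p 0 := Real.rpow_nonneg (hY 0) _
  have hC0 : 0 ≤ C := by positivity
  have hbound (l : ℕ) : Y l ≤ C ^ (κ ^ (l : ℝ) / p l) := by
    have hpl : 0 < p l := by linarith [hp l]
    have h := le_rpow_of_succ_le_rpow (Z := fun l => Y l ^ p l) hκ hA.le hB.le
      (fun l => Real.rpow_nonneg (hY l) _) hrec l
    rw [← Real.rpow_le_rpow_iff (hY l) (by positivity) hpl, ← Real.rpow_mul hC0,
      div_mul_cancel₀ _ hpl.ne']
    exact h
  have htend : Tendsto (fun l : ℕ => C ^ (κ ^ (l : ℝ) / p l)) atTop (nhds (C ^ (1 / μ))) :=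
    (Real.continuousAt_const_rpow' (by positivity)).tendsto.comp hlim
  have hCμ : C ^ (1 / μ) =
      A ^ ((κ / (κ - 1)) / μ) * B ^ ((κ / (κ - 1)) ^ 2 / μ) * Y 0 ^ (p 0 / μ) := by
    rw [hC, Real.mul_rpow (by positivity) hZ0, Real.mul_rpow (by positivity) (by positivity),
      ← Real.rpow_mul hA0.le, ← Real.rpow_mul hB0.le, ← Real.rpow_mul (hY 0)]
    simp only [mul_one_div]
  rw [← hCμ, ← htend.limsup_eq]
  exact limsup_le_limsup (Eventually.of_forall hbound)
    (isBoundedUnder_of ⟨0, hY⟩).isCoboundedUnder_le htend.isBoundedUnder_le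
end

section
/- Let 1 < p ≤ 2 and ε ∈ (0,1). There exists a constant c = c(p) > 0, independent of ε, with the following property: if λ > 0 and F : ℝ^n → ℝ is a C² function whose Hessian satisfies ⟨∇²F(z)v, v⟩ ≥ λ·(ε² + |z|²)^{p/2 − 1}·|v|² for all z, v ∈ ℝ^n, then ⟨∇F(z) − ∇F(w), z − w⟩ ≥ c·λ·(ε² + |z|² + |w|²)^{p/2 − 1}·|z − w|² for all z, w ∈ ℝ^n. -/
open scoped RealInnerProductSpace

/-- On a segment the squared norm is at most the sum of the squared norms of the endpoints. -/
theorem norm_add_smul_sub_sq_le {E : Type*} [NormedAddCommGroup E] [InnerProductSpace ℝ E]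
    (z w : E) {t : ℝ} (ht0 : 0 ≤ t) (ht1 : t ≤ 1) :
    ‖w + t • (z - w)‖ ^ 2 ≤ ‖z‖ ^ 2 + ‖w‖ ^ 2 := by
  have h : ‖w + t • (z - w)‖ ≤ (1 - t) * ‖w‖ + t * ‖z‖ := by
    calc ‖w + t • (z - w)‖ = ‖(1 - t) • w + t • z‖ := by congr 1; module
      _ ≤ ‖(1 - t) • w‖ + ‖t • z‖ := norm_add_le _ _
      _ = (1 - t) * ‖w‖ + t * ‖z‖ := by
        rw [norm_smul, norm_smul, Real.norm_of_nonneg ht0,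
          Real.norm_of_nonneg (sub_nonneg.2 ht1)]
  have h1t : 0 ≤ 1 - t := sub_nonneg.2 ht1
  calc ‖w + t • (z - w)‖ ^ 2 ≤ ((1 - t) * ‖w‖ + t * ‖z‖) ^ 2 := by gcongr
    _ ≤ (1 - t) * ‖w‖ ^ 2 + t * ‖z‖ ^ 2 := by
      nlinarith [mul_nonneg (mul_nonneg ht0 h1t) (sq_nonneg (‖w‖ - ‖z‖))]
    _ ≤ ‖z‖ ^ 2 + ‖w‖ ^ 2 := by
      nlinarith [mul_nonneg ht0 (sq_nonneg ‖w‖), mul_nonneg h1t (sq_nonneg ‖z‖)]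

/-- A lower bound for the derivative of a vector field along a segment gives the corresponding
lower bound for its increment. -/
theorem le_inner_sub_of_le_inner_fderiv {E : Type*} [NormedAddCommGroup E]
    [InnerProductSpace ℝ E] {G : E → E} (hG : Differentiable ℝ G) (z w : E) {C : ℝ}
    (hC : ∀ t ∈ Set.Icc (0 : ℝ) 1, C ≤ ⟪fderiv ℝ G (w + t • (z - w)) (z - w), z - w⟫) :
    C ≤ ⟪G z - G w, z - w⟫ := by
  have hd : ∀ t : ℝ, HasDerivAt (fun t : ℝ => ⟪G (w + t • (z - w)), z - w⟫)
      ⟪fderiv ℝ G (w + t • (z - w)) (z - w), z - w⟫ t := by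
    intro t
    have hline : HasDerivAt (fun t : ℝ => w + t • (z - w)) (z - w) t := by
      simpa using ((hasDerivAt_id t).smul_const (z - w)).const_add w
    simpa using ((hG _).hasFDerivAt.comp_hasDerivAt t hline).inner ℝ
      (hasDerivAt_const t (z - w))
  obtain ⟨t, ht, h⟩ := exists_hasDerivAt_eq_slope _ _ (zero_lt_one (α := ℝ))
    (fun t _ => (hd t).continuousAt.continuousWithinAt) (fun t _ => hd t)
  have := hC t (Set.Ioo_subset_Icc_self ht)
  rw [h] at this
  simpa [inner_sub_left] using this

/-- Strong monotonicity from a Hessian lower bound: for `1 < p ≤ 2` there is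
`c = c(p) > 0`, independent of `ε`, such that whenever `F : ℝ^n → ℝ` is `C²` with
`⟪∇²F(z) v, v⟫ ≥ λ (ε² + |z|²)^{p/2-1} |v|²`, its gradient satisfies
`⟪∇F(z) - ∇F(w), z - w⟫ ≥ c λ (ε² + |z|² + |w|²)^{p/2-1} |z - w|²`. -/
theorem stmt10 (p : ℝ) (hp1 : 1 < p) (hp2 : p ≤ 2) :
    ∃ c : ℝ, 0 < c ∧
      ∀ (n : ℕ) (ε : ℝ), ε ∈ Set.Ioo (0 : ℝ) 1 →
        ∀ (lam : ℝ), 0 < lam →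
          ∀ F : EuclideanSpace ℝ (Fin n) → ℝ, ContDiff ℝ 2 F →
            (∀ z v : EuclideanSpace ℝ (Fin n),
              lam * (ε ^ 2 + ‖z‖ ^ 2) ^ (p / 2 - 1) * ‖v‖ ^ 2 ≤
                ⟪fderiv ℝ (gradient F) z v, v⟫) →
            ∀ z w : EuclideanSpace ℝ (Fin n),
              c * lam * (ε ^ 2 + ‖z‖ ^ 2 + ‖w‖ ^ 2) ^ (p / 2 - 1) * ‖z - w‖ ^ 2 ≤
                ⟪gradient F z - gradient F w, z - w⟫ := by
  refine ⟨1, one_pos, ?_⟩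
  rintro n ε ⟨hε, -⟩ lam hlam F - hF z w
  rcases eq_or_ne z w with rfl | hzw
  · simp
  have hv : 0 < ‖z - w‖ := norm_pos_iff.2 (sub_ne_zero.2 hzw)
  -- Where the gradient is not differentiable its `fderiv` is `0`, which `hF` excludes.
  have hG : Differentiable ℝ (gradient F) := by
    intro x
    by_contra hx
    have h := hF x (z - w)
    rw [fderiv_zero_of_not_differentiableAt hx] at h
    simp only [zero_apply, inner_zero_left] at h
    exact absurd h (not_le.2 (by positivity))
  refine le_inner_sub_of_le_inner_fderiv hG z w fun t ht => le_trans ?_ (hF _ _)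
  rw [one_mul]
  have hpow : (ε ^ 2 + ‖z‖ ^ 2 + ‖w‖ ^ 2) ^ (p / 2 - 1) ≤
      (ε ^ 2 + ‖w + t • (z - w)‖ ^ 2) ^ (p / 2 - 1) := by
    apply Real.rpow_le_rpow_of_nonpos (by positivity) _ (by linarith)
    linarith [norm_add_smul_sub_sq_le z w ht.1 ht.2]
  gcongr
end
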